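/- arXiv:1207.5302 — 2 statements merged into one kernel-verified Lean document; each statement's English description precedes it below -/
import Mathlib

section
/- For every x > 0, W[φ̃₂^I(·;15/2), φ̃₁^II(·;15/2)](x) = (6 + x²)³ (14 + x²); in particular, as a polynomial in η = x², this Wronskian has a zero of order exactly 3 at η = −6 and a simple zero at η = −14, and it has no zeros on (0,∞). -/
/-- The degree-`v` generalized Laguerre polynomial `L_v^{(α)}(y)` for `v ∈ {1,2,3}`. -/
noncomputable def Lv (v : ℕ) (α y : ℝ) : ℝ :=
  if v = 1 then α + 1 - y
  else if v = 2 then ((α+1)*(α+2) - 2*(α+2)*y + y^2)/2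
  else ((α+1)*(α+2)*(α+3) - 3*(α+2)*(α+3)*y + 3*(α+3)*y^2 - y^3)/6

/-- Type I seed function `φ̃_v^I(x;g) = e^{x²/2} x^g L_v^{(g-1/2)}(-x²)`. -/
noncomputable def seedI (v : ℕ) (g x : ℝ) : ℝ :=
  Real.exp (x^2/2) * x ^ g * Lv v (g - 1/2) (-x^2)

/-- Type II seed function `φ̃_v^II(x;g) = e^{-x²/2} x^{1-g} L_v^{(1/2-g)}(x²)`. -/
noncomputable def seedII (v : ℕ) (g x : ℝ) : ℝ :=
  Real.exp (-x^2/2) * x ^ (1-g) * Lv v (1/2 - g) (x^2)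

/-- Type III seed function `φ̃_v^III(x;g) = e^{x²/2} x^{1-g} L_v^{(1/2-g)}(-x²)`. -/
noncomputable def seedIII (v : ℕ) (g x : ℝ) : ℝ :=
  Real.exp (x^2/2) * x ^ (1-g) * Lv v (1/2 - g) (-x^2)

/-- The Wronskian `W[f,g](x) = f(x)g'(x) - f'(x)g(x)`. -/
noncomputable def Wr (f g : ℝ → ℝ) (x : ℝ) : ℝ :=
  f x * deriv g x - deriv f x * g x

theorem hasDerivAt_exp_mul_rpow_mul {u p : ℝ → ℝ} {u' p' a x : ℝ} (hx : 0 < x)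
    (hu : HasDerivAt u u' x) (hp : HasDerivAt p p' x) :
    HasDerivAt (fun t => Real.exp (u t) * t ^ a * p t)
      (Real.exp (u x) * x ^ a * (u' * p x + a / x * p x + p')) x := by
  refine ((hu.exp.mul (Real.hasDerivAt_rpow_const (p := a) (Or.inl hx.ne'))).mul hp).congr_deriv ?_
  rw [Real.rpow_sub_one hx.ne']
  simp only [Pi.mul_apply]
  ring

theorem Wr_exp_mul_rpow_mul {u v p q : ℝ → ℝ} {u' v' p' q' a b x : ℝ} (hx : 0 < x)
    (hu : HasDerivAt u u' x) (hv : HasDerivAt v v' x)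
    (hp : HasDerivAt p p' x) (hq : HasDerivAt q q' x) :
    Wr (fun t => Real.exp (u t) * t ^ a * p t) (fun t => Real.exp (v t) * t ^ b * q t) x =
      Real.exp (u x + v x) * x ^ (a + b) *
        (((v' - u') + (b - a) / x) * (p x * q x) + p x * q' - p' * q x) := by
  rw [Wr, (hasDerivAt_exp_mul_rpow_mul hx hu hp).deriv,
    (hasDerivAt_exp_mul_rpow_mul hx hv hq).deriv, Real.exp_add, Real.rpow_add hx]
  ring

theorem rootMultiplicity_X_sub_C_pow_mul {R : Type*} [CommRing R] [IsDomain R] {p : Polynomial R}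
    {a : R} (n : ℕ) (h : p.eval a ≠ 0) :
    Polynomial.rootMultiplicity a ((Polynomial.X - Polynomial.C a) ^ n * p) = n := by
  have hp : p ≠ 0 := by
    rintro rfl
    simp at h
  rw [Polynomial.rootMultiplicity_mul
      (mul_ne_zero (pow_ne_zero _ (Polynomial.X_sub_C_ne_zero a)) hp),
    Polynomial.rootMultiplicity_X_sub_C_pow, Polynomial.rootMultiplicity_eq_zero h, add_zero]

/-- at `g = 15/2`, `W[φ̃₂^I, φ̃₁^II](x) = (6+x²)³(14+x²)`; as a polynomial in
`η = x²` it has a zero of order exactly 3 at `η = −6`, a simple zero at `η = −14`, and no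
zeros on `(0,∞)`. -/
theorem wronskian_E_cubic_zero :
    (∀ x : ℝ, 0 < x →
      Wr (seedI 2 (15/2)) (seedII 1 (15/2)) x = (6 + x^2)^3 * (14 + x^2)) ∧
    Polynomial.rootMultiplicity (-6 : ℝ)
      ((Polynomial.C 6 + Polynomial.X)^3 * (Polynomial.C 14 + Polynomial.X)) = 3 ∧
    Polynomial.rootMultiplicity (-14 : ℝ)
      ((Polynomial.C 6 + Polynomial.X)^3 * (Polynomial.C 14 + Polynomial.X)) = 1 ∧
    ∀ η : ℝ, 0 < η →
      Polynomial.eval η ((Polynomial.C 6 + Polynomial.X)^3 * (Polynomial.C 14 + Polynomial.X)) ≠ 0 := by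
  refine ⟨fun x hx => ?_, ?_, ?_, fun η hη => ?_⟩
  · have hsq : HasDerivAt (fun t : ℝ => t ^ 2) (2 * x) x := by
      simpa using hasDerivAt_pow 2 x
    have hu : HasDerivAt (fun t : ℝ => t ^ 2 / 2) x x :=
      (hsq.div_const 2).congr_deriv (by ring)
    have hv : HasDerivAt (fun t : ℝ => -t ^ 2 / 2) (-x) x :=
      (hsq.neg.div_const 2).congr_deriv (by ring)
    have hp : HasDerivAt (fun t : ℝ => (6 + t ^ 2) * (12 + t ^ 2) / 2)
        (2 * x * (9 + x ^ 2)) x :=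
      (((hsq.const_add 6).mul (hsq.const_add 12)).div_const 2).congr_deriv (by ring)
    have hq : HasDerivAt (fun t : ℝ => -(6 + t ^ 2)) (-(2 * x)) x := (hsq.const_add 6).neg
    have hI : seedI 2 (15/2) = fun t =>
        Real.exp (t ^ 2 / 2) * t ^ (15 / 2 : ℝ) * ((6 + t ^ 2) * (12 + t ^ 2) / 2) := by
      funext t
      simp only [seedI, Lv, OfNat.ofNat_ne_one, if_true, if_false]
      ring
    have hII : seedII 1 (15/2) = fun t =>
        Real.exp (-t ^ 2 / 2) * t ^ (1 - 15 / 2 : ℝ) * (-(6 + t ^ 2)) := by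
      funext t
      simp only [seedII, Lv, if_true]
      ring
    rw [hI, hII, Wr_exp_mul_rpow_mul hx hu hv hp hq]
    have hexp : x ^ 2 / 2 + -x ^ 2 / 2 = 0 := by ring
    have hpow : (15 / 2 + (1 - 15 / 2) : ℝ) = 1 := by norm_num
    rw [hexp, hpow, Real.exp_zero, Real.rpow_one]
    field_simp
    ring
  · refine (congrArg _ ?_).trans (rootMultiplicity_X_sub_C_pow_mul (a := (-6 : ℝ))
      (p := Polynomial.C 14 + Polynomial.X) 3 (by norm_num))
    rw [Polynomial.C_neg]
    ring
  · refine (congrArg _ ?_).trans (rootMultiplicity_X_sub_C_pow_mul (a := (-14 : ℝ))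
      (p := (Polynomial.C 6 + Polynomial.X) ^ 3) 1 (by norm_num))
    rw [Polynomial.C_neg]
    ring
  · simp only [Polynomial.eval_mul, Polynomial.eval_pow, Polynomial.eval_add,
      Polynomial.eval_C, Polynomial.eval_X]
    positivity
end

section
/- Define 𝓛ᴬ_n(η) := (−117 + 156η + 208η² + 64η³ − 4n(3+4η)²) L_n^{(1/4)}(η) − 4η(3+4η)(15+4η) (d/dη)L_n^{(1/4)}(η) for natural n ≥ 0, and 𝓛ᴬ_{−2}(η) := 15 + 4η. Then for all indices n, m ∈ {−2, 0, 1, 2, ...} with n ≠ m, the integral ∫₀^∞ e^{−η} η^{1/4} (3+4η)^{−4} 𝓛ᴬ_n(η) 𝓛ᴬ_m(η) dη = 0, and for every natural n ≥ 0, ∫₀^∞ e^{−η} η^{1/4} (3+4η)^{−4} 𝓛ᴬ_n(η)² dη = 4(n+2)(4n+13) Γ(n + 5/4) / n!. -/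
/-- The generalized Laguerre polynomial
`L_n^{(α)}(y) = Σ_{k=0}^{n} ((−1)^k/(k!(n−k)!)) (Π_{j=k+1}^{n} (α+j)) y^k`. -/
noncomputable def genLag (n : ℕ) (α : ℝ) (y : ℝ) : ℝ :=
  ∑ k ∈ Finset.range (n+1),
    ((-1:ℝ)^k / ((Nat.factorial k : ℝ) * (Nat.factorial (n-k) : ℝ)))
      * (∏ j ∈ Finset.Icc (k+1) n, (α + (j:ℝ))) * y^k

/-- The polynomial `𝓛ᴬ_n(η)` of case (A). -/
noncomputable def LA (n : ℕ) (η : ℝ) : ℝ :=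
  (-117 + 156*η + 208*η^2 + 64*η^3 - 4*(n:ℝ)*(3+4*η)^2) * genLag n (1/4) η
    - 4*η*(3+4*η)*(15+4*η) * deriv (genLag n (1/4)) η

/-- The members of family (A), indexed by `{−2, 0, 1, 2, …} ⊂ ℤ`, with the extra member
`𝓛ᴬ_{−2}(η) = 15 + 4η`. -/
noncomputable def LAidx (n : ℤ) (η : ℝ) : ℝ :=
  if n = -2 then 15 + 4*η else LA n.toNat η

section

open MeasureTheory Polynomial Set Filter Topology

/-- The generalized Laguerre polynomial as an element of `ℝ[X]`. -/
noncomputable def genLagPoly (n : ℕ) (α : ℝ) : ℝ[X] :=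
  ∑ k ∈ Finset.range (n + 1),
    C (((-1 : ℝ) ^ k / ((Nat.factorial k : ℝ) * (Nat.factorial (n - k) : ℝ)))
      * (∏ j ∈ Finset.Icc (k + 1) n, (α + (j : ℝ)))) * X ^ k

lemma eval_genLagPoly (n : ℕ) (α x : ℝ) : (genLagPoly n α).eval x = genLag n α x := by
  simp only [genLagPoly, genLag, eval_finsetSum, eval_mul, eval_C, eval_pow, eval_X]

lemma deriv_genLag (n : ℕ) (α x : ℝ) :
    deriv (genLag n α) x = (derivative (genLagPoly n α)).eval x := by
  have : genLag n α = fun x => (genLagPoly n α).eval x := by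
    ext x; rw [eval_genLagPoly]
  rw [this, Polynomial.deriv]

lemma coeff_genLagPoly (n : ℕ) (α : ℝ) (k : ℕ) :
    (genLagPoly n α).coeff k = if k ≤ n then
      ((-1 : ℝ) ^ k / ((Nat.factorial k : ℝ) * (Nat.factorial (n - k) : ℝ)))
      * (∏ j ∈ Finset.Icc (k + 1) n, (α + (j : ℝ))) else 0 := by
  simp only [genLagPoly, finsetSum_coeff, coeff_C_mul, coeff_X_pow]
  simp

lemma coeff_genLagPoly_succ (n : ℕ) (α : ℝ) (k : ℕ) :
    ((k : ℝ) + 1) * (α + (k + 1)) * (genLagPoly n α).coeff (k + 1)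
      = -((n : ℝ) - k) * (genLagPoly n α).coeff k := by
  rcases lt_trichotomy k n with h | rfl | h
  · obtain ⟨d, rfl⟩ := Nat.exists_eq_add_of_lt h
    rw [coeff_genLagPoly, coeff_genLagPoly, if_pos (by omega), if_pos (by omega),
      ← Finset.mul_prod_Ioc_eq_prod_Icc (a := k + 1) (by omega), ← Finset.Icc_add_one_left_eq_Ioc,
      show k + d + 1 - (k + 1) = d by omega, show k + d + 1 - k = d + 1 by omega,
      Nat.factorial_succ, Nat.factorial_succ, pow_succ]
    push_cast
    field_simp
    ring
  · simp [coeff_genLagPoly]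
  · rw [coeff_genLagPoly, coeff_genLagPoly, if_neg (by omega), if_neg (by omega)]
    simp

/-- Laguerre's differential equation. -/
lemma genLagPoly_ode (n : ℕ) (α : ℝ) :
    X * derivative (derivative (genLagPoly n α))
      + (C (α + 1) - X) * derivative (genLagPoly n α) + C (n : ℝ) * genLagPoly n α = 0 := by
  ext k
  have h := coeff_genLagPoly_succ n α k
  have hC : ((C (α + 1)) * derivative (genLagPoly n α)).coeff k
      = (α + 1) * ((genLagPoly n α).coeff (k + 1) * (k + 1)) := by
    rw [coeff_C_mul, coeff_derivative]
  simp only [sub_mul, coeff_add, coeff_sub, hC]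
  rcases k with _ | k
  · simp [mul_coeff_zero, coeff_derivative] at h ⊢
    linarith
  · simp [coeff_X_mul, coeff_derivative] at h ⊢
    linarith

lemma derivative_genLagPoly_succ (n : ℕ) (α : ℝ) :
    derivative (genLagPoly (n + 1) α) = -genLagPoly n (α + 1) := by
  ext k
  rw [coeff_derivative, coeff_neg, coeff_genLagPoly, coeff_genLagPoly]
  by_cases h : k ≤ n
  · have hprod : ∏ j ∈ Finset.Icc (k + 1 + 1) (n + 1), (α + (j : ℝ))
        = ∏ j ∈ Finset.Icc (k + 1) n, (α + 1 + (j : ℝ)) := by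
      rw [← Finset.map_add_right_Icc, Finset.prod_map]
      refine Finset.prod_congr rfl fun j _ => ?_
      simp only [addRightEmbedding_apply]
      push_cast
      ring
    rw [if_pos (by omega), if_pos h, hprod, Nat.factorial_succ, pow_succ,
      show n + 1 - (k + 1) = n - k by omega]
    push_cast
    field_simp
  · rw [if_neg (by omega), if_neg h]
    simp

lemma eval_ode (n : ℕ) (α x : ℝ) :
    x * (derivative (derivative (genLagPoly n α))).eval x
      = (x - (α + 1)) * (derivative (genLagPoly n α)).eval x - n * (genLagPoly n α).eval x := by
  have h := congrArg (eval x) (genLagPoly_ode n α)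
  simp at h
  linarith

lemma integrableOn_exp_rpow_poly {α : ℝ} (hα : -1 < α) (N : ℝ[X]) :
    IntegrableOn (fun x : ℝ => Real.exp (-x) * x ^ α * N.eval x) (Ioi 0) := by
  induction N using Polynomial.induction_on' with
  | add p q hp hq =>
    refine (hp.add hq).congr_fun (fun x _ => ?_) measurableSet_Ioi
    simp [mul_add]
  | monomial i a =>
    have h := (Real.GammaIntegral_convergent (s := α + i + 1)
      (by have : (0 : ℝ) ≤ i := by positivity
          linarith)).const_mul a
    refine IntegrableOn.congr_fun h (fun x hx => ?_) measurableSet_Ioi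
    have hx : (0 : ℝ) < x := hx
    simp only [eval_monomial, add_sub_cancel_right, Real.rpow_add hx, Real.rpow_natCast]
    ring

lemma norm_inv_three_add_pow_le {x : ℝ} (hx : 0 ≤ x) (k : ℕ) : ‖((3 + 4 * x) ^ k)⁻¹‖ ≤ 1 := by
  rw [Real.norm_of_nonneg (by positivity)]
  exact inv_le_one_of_one_le₀ (one_le_pow₀ (by linarith))

lemma integrableOn_exp_rpow_poly_div {α : ℝ} (hα : -1 < α) (N : ℝ[X]) (k : ℕ) :
    IntegrableOn (fun x : ℝ => Real.exp (-x) * x ^ α * (N.eval x / (3 + 4 * x) ^ k)) (Ioi 0) := by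
  have h := (integrableOn_exp_rpow_poly hα N).mul_bdd (c := 1)
    (g := fun x : ℝ => ((3 + 4 * x) ^ k)⁻¹) (by fun_prop)
    ((ae_restrict_iff' measurableSet_Ioi).2 (.of_forall fun x hx =>
      norm_inv_three_add_pow_le (le_of_lt hx) k))
  refine h.congr (.of_forall fun x => ?_)
  simp only [div_eq_mul_inv]
  ring

lemma tendsto_exp_rpow_poly (β : ℝ) (N : ℝ[X]) :
    Tendsto (fun x : ℝ => Real.exp (-x) * x ^ β * N.eval x) atTop (𝓝 0) := by
  induction N using Polynomial.induction_on' with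
  | add p q hp hq =>
    simpa [mul_add] using hp.add hq
  | monomial i a =>
    have h := (tendsto_rpow_mul_exp_neg_mul_atTop_nhds_zero (β + i) 1 one_pos).const_mul a
    rw [mul_zero] at h
    refine h.congr' ?_
    filter_upwards [eventually_gt_atTop 0] with x hx
    simp only [eval_monomial, Real.rpow_add hx, Real.rpow_natCast, neg_mul, one_mul]
    ring

/-- The integral of the derivative of `e^{-x} x^{α+1} N(x) / (3+4x)^k` vanishes. -/
lemma integral_exp_rpow_deriv_eq_zero {α : ℝ} (hα : -1 < α) (N : ℝ[X]) (k : ℕ) :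
    ∫ x in Ioi (0 : ℝ), Real.exp (-x) * x ^ α *
      ((((C (α + 1) - X) * N + X * derivative N) * (C 3 + C 4 * X)
        - C (4 * (k : ℝ)) * X * N).eval x / (3 + 4 * x) ^ (k + 1)) = 0 := by
  have hF : ∀ x ∈ Ioi (0 : ℝ), HasDerivAt
      (fun x : ℝ => Real.exp (-x) * x ^ (α + 1) * (N.eval x / (3 + 4 * x) ^ k))
      (Real.exp (-x) * x ^ α *
      ((((C (α + 1) - X) * N + X * derivative N) * (C 3 + C 4 * X)
        - C (4 * (k : ℝ)) * X * N).eval x / (3 + 4 * x) ^ (k + 1))) x := by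
    intro x hx
    have hx : (0 : ℝ) < x := hx
    have hs : (3 + 4 * x) ≠ 0 := by positivity
    have h1 := (hasDerivAt_neg x).exp
    have h2 := Real.hasDerivAt_rpow_const (x := x) (p := α + 1) (Or.inl hx.ne')
    have h3 := N.hasDerivAt x
    have h4 := (((hasDerivAt_id x).const_mul 4).const_add 3).pow k
    have h5 := (h1.mul h2).mul (h3.div h4 (pow_ne_zero k hs))
    refine h5.congr_deriv ?_
    simp only [add_sub_cancel_right, Real.rpow_add_one hx.ne', id, Pi.mul_apply, Pi.pow_apply,
      Pi.div_apply]
    simp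
    rcases k with _ | k
    · simp
      field_simp
      ring
    · simp [pow_succ]
      field_simp
      ring
  have h0 : ContinuousWithinAt
      (fun x : ℝ => Real.exp (-x) * x ^ (α + 1) * (N.eval x / (3 + 4 * x) ^ k)) (Ici 0) 0 := by
    have : ContinuousAt (fun x : ℝ => x ^ (α + 1)) 0 :=
      Real.continuousAt_rpow_const _ _ (Or.inr (by linarith))
    refine ContinuousAt.continuousWithinAt ?_
    refine ContinuousAt.mul (by fun_prop) (ContinuousAt.div N.continuous.continuousAt
      (by fun_prop) (by simp))
  have htop : Tendsto
      (fun x : ℝ => Real.exp (-x) * x ^ (α + 1) * (N.eval x / (3 + 4 * x) ^ k)) atTop (𝓝 0) := by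
    refine squeeze_zero_norm' ?_ (tendsto_zero_iff_norm_tendsto_zero.1
      (tendsto_exp_rpow_poly (α + 1) N))
    filter_upwards [eventually_ge_atTop 0] with x hx
    rw [div_eq_mul_inv, ← mul_assoc, norm_mul]
    exact mul_le_of_le_one_right (norm_nonneg _) (norm_inv_three_add_pow_le hx k)
  have := integral_Ioi_of_hasDerivAt_of_tendsto h0 hF
    (integrableOn_exp_rpow_poly_div hα _ _) htop
  rw [this]
  simp [Real.zero_rpow (show α + 1 ≠ 0 by linarith)]

lemma integral_genLagPoly_mul_of_ne {α : ℝ} (hα : -1 < α) {n m : ℕ} (hnm : n ≠ m) :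
    ∫ x in Ioi (0 : ℝ), Real.exp (-x) * x ^ α *
      ((genLagPoly n α).eval x * (genLagPoly m α).eval x) = 0 := by
  have h := integral_exp_rpow_deriv_eq_zero hα
    (genLagPoly n α * derivative (genLagPoly m α) - derivative (genLagPoly n α) * genLagPoly m α) 0
  have hne : (n : ℝ) - m ≠ 0 := sub_ne_zero.2 (by exact_mod_cast hnm)
  refine (mul_eq_zero.1 (?_ : ((n : ℝ) - m) * _ = 0)).resolve_left hne
  rw [← integral_const_mul]
  refine Eq.trans ?_ h
  refine setIntegral_congr_fun measurableSet_Ioi fun x hx => ?_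
  have hx : (0 : ℝ) < x := hx
  have hn := eval_ode n α x
  have hm := eval_ode m α x
  simp only [derivative_sub, derivative_mul, eval_sub, eval_add, eval_mul, eval_C, eval_X,
    Nat.cast_zero, mul_zero, zero_mul, sub_zero, zero_add, pow_one]
  rw [mul_div_assoc, div_self (show 3 + 4 * x ≠ 0 by positivity)]
  linear_combination Real.exp (-x) * x ^ α *
    ((genLagPoly m α).eval x * hn - (genLagPoly n α).eval x * hm)

lemma integral_genLagPoly_sq (n : ℕ) {α : ℝ} (hα : -1 < α) :
    ∫ x in Ioi (0 : ℝ), Real.exp (-x) * x ^ α * ((genLagPoly n α).eval x) ^ 2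
      = Real.Gamma (α + n + 1) / (Nat.factorial n : ℝ) := by
  induction n generalizing α with
  | zero =>
    rw [Real.Gamma_eq_integral (by simpa using by linarith)]
    simp [genLagPoly]
  | succ n ih =>
    have h := integral_exp_rpow_deriv_eq_zero hα
      (genLagPoly (n + 1) α * derivative (genLagPoly (n + 1) α)) 0
    have ih' := ih (α := α + 1) (by linarith)
    have hi := (integrableOn_exp_rpow_poly hα ((genLagPoly (n + 1) α) ^ 2)).const_mul
      ((n : ℝ) + 1)
    have hj := integrableOn_exp_rpow_poly (α := α + 1) (by linarith) ((genLagPoly n (α + 1)) ^ 2)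
    simp only [eval_pow] at hi hj
    have key : (((n : ℝ) + 1) * ∫ x in Ioi (0 : ℝ),
        Real.exp (-x) * x ^ α * ((genLagPoly (n + 1) α).eval x) ^ 2)
        = ∫ x in Ioi (0 : ℝ),
          Real.exp (-x) * x ^ (α + 1) * ((genLagPoly n (α + 1)).eval x) ^ 2 := by
      rw [← sub_eq_zero, ← integral_const_mul, ← integral_sub hi hj, ← neg_eq_zero,
        ← integral_neg]
      refine Eq.trans ?_ h
      refine setIntegral_congr_fun measurableSet_Ioi fun x hx => ?_
      have hx : (0 : ℝ) < x := hx
      have hn := eval_ode (n + 1) α x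
      have hd : (genLagPoly n (α + 1)).eval x
          = -(derivative (genLagPoly (n + 1) α)).eval x := by
        rw [derivative_genLagPoly_succ]; simp
      push_cast at hn
      simp only [derivative_mul, eval_sub, eval_add, eval_mul, eval_C, eval_X, hd,
        Nat.cast_zero, mul_zero, zero_mul, sub_zero, zero_add, pow_one, Real.rpow_add_one hx.ne']
      rw [mul_div_assoc, div_self (show 3 + 4 * x ≠ 0 by positivity)]
      linear_combination -Real.exp (-x) * x ^ α * (genLagPoly (n + 1) α).eval x * hn
    rw [ih'] at key
    rw [Nat.factorial_succ]
    push_cast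
    rw [show α + (n + 1) + 1 = α + 1 + n + 1 by ring, eq_div_iff (by positivity)]
    rw [eq_div_iff (by positivity)] at key
    linear_combination key

/-- The polynomial `LA n` as an element of `ℝ[X]`. -/
noncomputable def LAPoly (n : ℕ) : ℝ[X] :=
  (-C 117 + C 156 * X + C 208 * X ^ 2 + C 64 * X ^ 3 - C (4 * (n : ℝ)) * (C 3 + C 4 * X) ^ 2)
      * genLagPoly n (1 / 4)
    - C 4 * X * (C 3 + C 4 * X) * (C 15 + C 4 * X) * derivative (genLagPoly n (1 / 4))

lemma eval_LAPoly (n : ℕ) (x : ℝ) : (LAPoly n).eval x = LA n x := by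
  simp [LAPoly, LA, eval_genLagPoly, deriv_genLag]


lemma integrableOn_genLagPoly_mul (n m : ℕ) :
    IntegrableOn (fun x : ℝ => Real.exp (-x) * x ^ ((1 : ℝ) / 4) *
      ((genLagPoly n (1 / 4)).eval x * (genLagPoly m (1 / 4)).eval x)) (Ioi 0) := by
  have h := integrableOn_exp_rpow_poly (α := 1 / 4) (by norm_num)
    (genLagPoly n (1 / 4) * genLagPoly m (1 / 4))
  simpa only [eval_mul] using h

/-- The polynomial first-order expression equal to the derivative of `LAPoly m`, obtained from
Laguerre's differential equation. -/
noncomputable def LAPolyDeriv (m : ℕ) : ℝ[X] :=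
  (C 156 + C 416 * X + C 192 * X ^ 2 - C (32 * (m : ℝ)) * (C 3 + C 4 * X)
      + C (4 * (m : ℝ)) * (C 3 + C 4 * X) * (C 15 + C 4 * X)) * genLagPoly m (1 / 4)
    + (-C 117 + C 156 * X + C 208 * X ^ 2 + C 64 * X ^ 3 - C (4 * (m : ℝ)) * (C 3 + C 4 * X) ^ 2
      - C 4 * ((C 3 + C 8 * X) * (C 15 + C 4 * X) + C 4 * X * (C 3 + C 4 * X))
      - C 4 * (C 3 + C 4 * X) * (C 15 + C 4 * X) * (X - C (5 / 4)))
        * derivative (genLagPoly m (1 / 4))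

lemma integral_LA_mul_LA (n m : ℕ) :
    ∫ x in Ioi (0 : ℝ), Real.exp (-x) * x ^ ((1 : ℝ) / 4) / (3 + 4 * x) ^ 4 * (LA n x * LA m x)
      = 4 * ((m : ℝ) + 2) * (4 * (m : ℝ) + 13) *
        ∫ x in Ioi (0 : ℝ), Real.exp (-x) * x ^ ((1 : ℝ) / 4) *
          ((genLagPoly n (1 / 4)).eval x * (genLagPoly m (1 / 4)).eval x) := by
  have hα : (-1 : ℝ) < 1 / 4 := by norm_num
  set N : ℝ[X] := C 4 * (C 3 + C 4 * X) * derivative (genLagPoly n (1 / 4)) * LAPoly m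
    - C 4 * genLagPoly n (1 / 4) *
      ((C 3 + C 4 * X) * LAPolyDeriv m + (C 7 + C 4 * X) * LAPoly m) with hN
  have h := integral_exp_rpow_deriv_eq_zero hα N 3
  have hD := integrableOn_exp_rpow_poly_div hα
    (((C (1 / 4 + 1) - X) * N + X * derivative N) * (C 3 + C 4 * X)
        - C (4 * ((3 : ℕ) : ℝ)) * X * N) (3 + 1)
  have hadd := integral_add
    ((integrableOn_genLagPoly_mul n m).const_mul (4 * ((m : ℝ) + 2) * (4 * (m : ℝ) + 13))) hD
  rw [h, add_zero, integral_const_mul] at hadd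
  rw [← hadd]
  refine setIntegral_congr_fun measurableSet_Ioi fun x hx => ?_
  have hx : (0 : ℝ) < x := hx
  have hs : 3 + 4 * x ≠ 0 := by positivity
  have hy := eval_ode n (1 / 4) x
  have hz := eval_ode m (1 / 4) x
  have key : (((C (1 / 4 + 1) - X) * N + X * derivative N) * (C 3 + C 4 * X)
        - C (4 * ((3 : ℕ) : ℝ)) * X * N).eval x
      = LA n x * LA m x - 4 * ((m : ℝ) + 2) * (4 * (m : ℝ) + 13) * (3 + 4 * x) ^ 4 *
        ((genLagPoly n (1 / 4)).eval x * (genLagPoly m (1 / 4)).eval x) := by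
    rw [← eval_LAPoly, ← eval_LAPoly, hN, LAPolyDeriv, LAPoly, LAPoly]
    simp only [derivative_add, derivative_sub, derivative_mul, derivative_neg, derivative_C,
      derivative_X, derivative_pow, eval_add, eval_sub, eval_mul, eval_neg,
      eval_pow, eval_C, eval_X, eval_zero, eval_one]
    generalize eval x (derivative (derivative (genLagPoly n (1 / 4)))) = y2 at *
    generalize eval x (derivative (derivative (genLagPoly m (1 / 4)))) = z2 at *
    generalize eval x (derivative (genLagPoly n (1 / 4))) = y1 at *
    generalize eval x (derivative (genLagPoly m (1 / 4))) = z1 at *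
    generalize eval x (genLagPoly n (1 / 4)) = y at *
    generalize eval x (genLagPoly m (1 / 4)) = z at *
    generalize (n : ℝ) = n at *
    generalize (m : ℝ) = m at *
    push_cast
    linear_combination
      (4 * (3 + 4 * x) ^ 2 * ((-117 + 156 * x + 208 * x ^ 2 + 64 * x ^ 3
        - 4 * m * (3 + 4 * x) ^ 2) * z - 4 * x * (3 + 4 * x) * (15 + 4 * x) * z1)) * hy
      + (3 + 4 * x) * (4 * (3 + 4 * x) * y1 * (- 4 * x * (3 + 4 * x) * (15 + 4 * x))
        - 4 * y * ((3 + 4 * x) * (-117 + 156 * x + 208 * x ^ 2 + 64 * x ^ 3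
          - 4 * m * (3 + 4 * x) ^ 2 - 4 * ((3 + 8 * x) * (15 + 4 * x) + 4 * x * (3 + 4 * x))
          - 4 * (3 + 4 * x) * (15 + 4 * x) * (x - 5 / 4))
          + (7 + 4 * x) * (- 4 * x * (3 + 4 * x) * (15 + 4 * x)))) * hz
  simp only [key]
  field_simp
  ring

lemma integral_linear_mul_LA (n : ℕ) :
    ∫ x in Ioi (0 : ℝ),
      Real.exp (-x) * x ^ ((1 : ℝ) / 4) / (3 + 4 * x) ^ 4 * (LA n x * (15 + 4 * x)) = 0 := by
  have hα : (-1 : ℝ) < 1 / 4 := by norm_num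
  set N : ℝ[X] := C 4 * (C 3 + C 4 * X) * derivative (genLagPoly n (1 / 4)) * (C 15 + C 4 * X)
    - C 4 * genLagPoly n (1 / 4) *
      ((C 3 + C 4 * X) * C 4 + (C 7 + C 4 * X) * (C 15 + C 4 * X)) with hN
  refine Eq.trans ?_ (integral_exp_rpow_deriv_eq_zero hα N 3)
  refine setIntegral_congr_fun measurableSet_Ioi fun x hx => ?_
  have hx : (0 : ℝ) < x := hx
  have hs : 3 + 4 * x ≠ 0 := by positivity
  have hy := eval_ode n (1 / 4) x
  have key : (((C (1 / 4 + 1) - X) * N + X * derivative N) * (C 3 + C 4 * X)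
        - C (4 * ((3 : ℕ) : ℝ)) * X * N).eval x = LA n x * (15 + 4 * x) := by
    rw [← eval_LAPoly, hN, LAPoly]
    simp only [derivative_add, derivative_sub, derivative_mul, derivative_C,
      derivative_X, eval_add, eval_sub, eval_mul, eval_neg,
      eval_pow, eval_C, eval_X, eval_zero, eval_one]
    push_cast
    linear_combination 4 * (3 + 4 * x) ^ 2 * (15 + 4 * x) * hy
  simp only [key]
  ring

end

/-- orthogonality of the family `{𝓛ᴬ_n}_{n ∈ {−2,0,1,2,…}}` with respect to
the weight `e^{−η} η^{1/4} (3+4η)^{−4}` on `(0,∞)`, and the norm of `𝓛ᴬ_n` for `n ≥ 0`. -/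
theorem LA_orthogonality :
    (∀ n m : ℤ, (n = -2 ∨ 0 ≤ n) → (m = -2 ∨ 0 ≤ m) → n ≠ m →
      ∫ η in Set.Ioi (0:ℝ),
        Real.exp (-η) * η ^ ((1:ℝ)/4) / (3+4*η)^4 * (LAidx n η * LAidx m η) = 0) ∧
    (∀ n : ℕ,
      ∫ η in Set.Ioi (0:ℝ),
        Real.exp (-η) * η ^ ((1:ℝ)/4) / (3+4*η)^4 * (LA n η)^2
      = 4*((n:ℝ)+2)*(4*(n:ℝ)+13) * Real.Gamma ((n:ℝ) + 5/4) / (Nat.factorial n : ℝ)) := by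
  refine ⟨fun n m hn hm hnm => ?_, fun n => ?_⟩
  · rcases hn with rfl | hn <;> rcases hm with rfl | hm
    · exact absurd rfl hnm
    · lift m to ℕ using hm
      have hm' : (m : ℤ) ≠ -2 := hnm.symm
      simpa only [LAidx, if_true, if_neg hm', Int.toNat_natCast, mul_comm (15 + 4 * _) (LA _ _)]
        using integral_linear_mul_LA m
    · lift n to ℕ using hn
      have hn' : (n : ℤ) ≠ -2 := hnm
      simpa only [LAidx, if_true, if_neg hn', Int.toNat_natCast] using integral_linear_mul_LA n
    · lift n to ℕ using hn
      lift m to ℕ using hm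
      have hn' : (n : ℤ) ≠ -2 := by omega
      have hm' : (m : ℤ) ≠ -2 := by omega
      simp only [LAidx, if_neg hn', if_neg hm', Int.toNat_natCast]
      rw [integral_LA_mul_LA, integral_genLagPoly_mul_of_ne (by norm_num) (by exact_mod_cast hnm),
        mul_zero]
  · simp only [pow_two (LA n _)]
    rw [integral_LA_mul_LA]
    simp only [← pow_two (Polynomial.eval _ _)]
    rw [integral_genLagPoly_sq n (by norm_num), show (1 / 4 : ℝ) + n + 1 = n + 5 / 4 by ring]
    ring
end
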